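/- arXiv:2506.02371 — 3 statements merged into one kernel-verified Lean document; each statement's English description precedes it below -/
import Mathlib

section
/- Let μ, ν, ρ be probability measures on a measurable space with μ ≪ ρ and ν ≪ ρ, let γ ∈ [0,1], and set π := (1−γ)μ + γν. Then, in the extended reals [0,∞], (1−γ)·KL(μ‖ρ) + γ·KL(ν‖ρ) = KL(π‖ρ) + (1−γ)·KL(μ‖π) + γ·KL(ν‖π). -/
open MeasureTheory ProbabilityTheory Real Classical
open scoped ENNReal NNReal

/-- KL divergence: `∫ log(dμ/dν) dμ ∈ [0,∞]` when `μ ≪ ν` (and the integral exists), `∞` otherwise. -/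
noncomputable def KL {α : Type*} [MeasurableSpace α] (μ ν : Measure α) : ℝ≥0∞ :=
  if μ ≪ ν ∧ Integrable (llr μ ν) μ then ENNReal.ofReal (∫ x, llr μ ν x ∂μ) else ⊤

open InformationTheory

lemma KL_eq_klDiv {α : Type*} [MeasurableSpace α] (μ ν : Measure α)
    [IsProbabilityMeasure μ] [IsProbabilityMeasure ν] : KL μ ν = klDiv μ ν := by
  simp [KL, klDiv_def]

lemma klFun_mul_add_klFun_mul {a b m r s : ℝ} (hab : a + b = 1)
    (h : a * (r * m) + b * (s * m) = m) :
    a * klFun (r * m) + b * klFun (s * m) = klFun m + m * (a * klFun r + b * klFun s) := by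
  have klFun_mul (t : ℝ) : klFun (t * m) = t * m * log m + m * klFun t + 1 - m := by
    rcases eq_or_ne m 0 with rfl | hm
    · simp [klFun]
    rcases eq_or_ne t 0 with rfl | ht
    · simp [klFun]
    rw [klFun, klFun, log_mul ht hm]
    ring
  rw [klFun_mul, klFun_mul, klFun_apply m]
  linear_combination (log m) * h + (1 - m) * hab

lemma klDiv_eq_lintegral_rnDeriv_mul {α : Type*} [MeasurableSpace α] {μ τ ρ : Measure α}
    [IsFiniteMeasure μ] [IsFiniteMeasure τ] [IsFiniteMeasure ρ] (hμτ : μ ≪ τ) (hτρ : τ ≪ ρ) :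
    klDiv μ τ
      = ∫⁻ x, τ.rnDeriv ρ x * ENNReal.ofReal (klFun (μ.rnDeriv τ x).toReal) ∂ρ := by
  rw [klDiv_eq_lintegral_klFun_of_ac hμτ, lintegral_rnDeriv_mul hτρ]
  fun_prop

/-- The compensation identity for a strict mixture, in terms of `klDiv`. -/
lemma klDiv_compensation {α : Type*} [MeasurableSpace α] {μ ν ρ : Measure α}
    [IsFiniteMeasure μ] [IsFiniteMeasure ν] [IsFiniteMeasure ρ] (hμρ : μ ≪ ρ) (hνρ : ν ≪ ρ)
    {a b : ℝ≥0} (ha : a ≠ 0) (hb : b ≠ 0) (hab : a + b = 1) :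
    a * klDiv μ ρ + b * klDiv ν ρ
      = klDiv (a • μ + b • ν) ρ + a * klDiv μ (a • μ + b • ν) + b * klDiv ν (a • μ + b • ν) := by
  set τ := a • μ + b • ν
  have hμτ : μ ≪ τ :=
    (Measure.absolutelyContinuous_smul (ENNReal.coe_ne_zero.2 ha)).add_right _
  have hντ : ν ≪ τ :=
    (Measure.absolutelyContinuous_smul (ENNReal.coe_ne_zero.2 hb)).add_right' _
  have hτρ : τ ≪ ρ := (hμρ.smul_left a).add_left (hνρ.smul_left b)
  rw [klDiv_eq_lintegral_rnDeriv_mul hμτ hτρ, klDiv_eq_lintegral_rnDeriv_mul hντ hτρ,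
    klDiv_eq_lintegral_klFun_of_ac hμρ, klDiv_eq_lintegral_klFun_of_ac hνρ,
    klDiv_eq_lintegral_klFun_of_ac hτρ,
    ← lintegral_const_mul _ (by fun_prop), ← lintegral_const_mul _ (by fun_prop),
    ← lintegral_const_mul _ (by fun_prop), ← lintegral_const_mul _ (by fun_prop),
    ← lintegral_add_left (by fun_prop), ← lintegral_add_left (by fun_prop),
    ← lintegral_add_left (by fun_prop)]
  refine lintegral_congr_ae ?_
  have h_add : τ.rnDeriv ρ =ᵐ[ρ] a • μ.rnDeriv ρ + b • ν.rnDeriv ρ := by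
    filter_upwards [Measure.rnDeriv_add (a • μ) (b • ν) ρ, Measure.rnDeriv_smul_left μ ρ a,
      Measure.rnDeriv_smul_left ν ρ b] with x h hμ hν
    rw [h, Pi.add_apply, Pi.add_apply, hμ, hν]
  filter_upwards [h_add, Measure.rnDeriv_mul_rnDeriv (κ := ρ) hμτ,
    Measure.rnDeriv_mul_rnDeriv (κ := ρ) hντ, μ.rnDeriv_lt_top ρ, ν.rnDeriv_lt_top ρ,
    τ.rnDeriv_lt_top ρ] with x h_add hμ hν hμ_top hν_top hτ_top
  have hμ' := congrArg ENNReal.toReal hμ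
  have hν' := congrArg ENNReal.toReal hν
  simp only [Pi.mul_apply, ENNReal.toReal_mul] at hμ' hν'
  have h_mix : a * (μ.rnDeriv ρ x).toReal + b * (ν.rnDeriv ρ x).toReal
      = (τ.rnDeriv ρ x).toReal := by
    rw [h_add]
    simp only [Pi.add_apply, Pi.smul_apply, ENNReal.smul_def, smul_eq_mul]
    rw [ENNReal.toReal_add (by finiteness) (by finiteness)]
    simp
  rw [← hμ', ← hν'] at h_mix
  have key := klFun_mul_add_klFun_mul (by exact_mod_cast hab) h_mix
  rw [hμ', hν'] at key
  have klFun_toReal_nonneg (y : ℝ≥0∞) : 0 ≤ klFun y.toReal := klFun_nonneg ENNReal.toReal_nonneg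
  have mul_klFun_nonneg (c : ℝ≥0) (y : ℝ≥0∞) : 0 ≤ c * klFun y.toReal :=
    mul_nonneg c.coe_nonneg (klFun_toReal_nonneg y)
  have h_ofReal := congrArg ENNReal.ofReal key
  rw [ENNReal.ofReal_add (mul_klFun_nonneg _ _) (mul_klFun_nonneg _ _),
    ENNReal.ofReal_add (klFun_toReal_nonneg _) (mul_nonneg ENNReal.toReal_nonneg
      (add_nonneg (mul_klFun_nonneg _ _) (mul_klFun_nonneg _ _))),
    ENNReal.ofReal_mul ENNReal.toReal_nonneg,
    ENNReal.ofReal_add (mul_klFun_nonneg _ _) (mul_klFun_nonneg _ _)] at h_ofReal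
  simp only [ENNReal.ofReal_mul (NNReal.coe_nonneg _), ENNReal.ofReal_coe_nnreal,
    ENNReal.ofReal_toReal hτ_top.ne] at h_ofReal
  rw [h_ofReal]
  ring

/-- compensation identity for KL.
For probability measures `μ, ν, ρ` with `μ ≪ ρ`, `ν ≪ ρ`, `γ ∈ [0,1]` and
`π := (1−γ)μ + γν`, one has, in `[0,∞]`,
`(1−γ)·KL(μ‖ρ) + γ·KL(ν‖ρ) = KL(π‖ρ) + (1−γ)·KL(μ‖π) + γ·KL(ν‖π)`. -/
theorem kl_compensation_identity {α : Type*} [MeasurableSpace α]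
    (μ ν ρ : Measure α) [IsProbabilityMeasure μ] [IsProbabilityMeasure ν] [IsProbabilityMeasure ρ]
    (hμρ : μ ≪ ρ) (hνρ : ν ≪ ρ) (γ : ℝ) (hγ : γ ∈ Set.Icc (0 : ℝ) 1) :
    ENNReal.ofReal (1 - γ) * KL μ ρ + ENNReal.ofReal γ * KL ν ρ
      = KL (ENNReal.ofReal (1 - γ) • μ + ENNReal.ofReal γ • ν) ρ
        + ENNReal.ofReal (1 - γ) * KL μ (ENNReal.ofReal (1 - γ) • μ + ENNReal.ofReal γ • ν)
        + ENNReal.ofReal γ * KL ν (ENNReal.ofReal (1 - γ) • μ + ENNReal.ofReal γ • ν) := by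
  obtain ⟨h0, h1⟩ := hγ
  rcases h0.eq_or_lt with rfl | h0
  · simp [KL_eq_klDiv]
  rcases h1.eq_or_lt with rfl | h1
  · simp [KL_eq_klDiv]
  have : IsProbabilityMeasure (ENNReal.ofReal (1 - γ) • μ + ENNReal.ofReal γ • ν) := ⟨by
    simp [← ENNReal.ofReal_add (sub_nonneg.2 h1.le) h0.le]⟩
  simp only [KL_eq_klDiv]
  exact klDiv_compensation hμρ hνρ (a := (1 - γ).toNNReal) (b := γ.toNNReal)
    (by simpa using h1) (by simpa using h0)
    (by rw [← Real.toNNReal_add (sub_nonneg.2 h1.le) h0.le]; simp)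
end

section
/- Let μ, ν be probability measures on a measurable space, let γ ∈ (0,1], and set π := (1−γ)μ + γν. Then for every probability measure ρ on the same space, (1−γ)·KL(μ‖π) + γ·KL(ν‖π) ≤ (1−γ)·KL(μ‖ρ) + γ·KL(ν‖ρ). In other words, the mixture π minimizes ρ ↦ (1−γ)·KL(μ‖ρ) + γ·KL(ν‖ρ) over all probability measures ρ. (This is the optimal solution of the γ-diffusion-projection step in the paper, Appendix A.2.) -/
open MeasureTheory ProbabilityTheory Real Classical
open scoped ENNReal NNReal

section Helpers

variable {α : Type*} [MeasurableSpace α] {μ ν ρ : Measure α}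

lemma llr_ae_eq_add_of_ac [SigmaFinite μ] [SigmaFinite ν] [SigmaFinite ρ]
    (hμν : μ ≪ ν) (hνρ : ν ≪ ρ) :
    llr μ ρ =ᵐ[μ] llr μ ν + llr ν ρ := by
  filter_upwards [(hμν.trans hνρ).ae_le (Measure.rnDeriv_mul_rnDeriv (κ := ρ) hμν),
    Measure.rnDeriv_pos hμν, hμν.ae_le (Measure.rnDeriv_lt_top μ ν),
    hμν.ae_le (Measure.rnDeriv_pos hνρ), (hμν.trans hνρ).ae_le (Measure.rnDeriv_lt_top ν ρ)]
    with x hx h1 h1' h2 h2'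
  simp only [llr, Pi.add_apply, ← hx, Pi.mul_apply, ENNReal.toReal_mul]
  exact Real.log_mul (ENNReal.toReal_pos h1.ne' h1'.ne).ne' (ENNReal.toReal_pos h2.ne' h2'.ne).ne'

lemma integrable_llr_of_smul_le [IsFiniteMeasure μ] [IsFiniteMeasure ν] (hμν : μ ≪ ν) {c : ℝ}
    (hc : 0 < c) (h : ENNReal.ofReal c • μ ≤ ν) : Integrable (llr μ ν) μ := by
  rw [← InformationTheory.integrable_klFun_rnDeriv_iff hμν]
  obtain ⟨C, hC⟩ := (isCompact_Icc (a := (0 : ℝ)) (b := c⁻¹)).exists_bound_of_continuousOn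
    InformationTheory.continuous_klFun.continuousOn
  refine Integrable.of_bound (InformationTheory.measurable_klFun.comp
    (Measure.measurable_rnDeriv μ ν).ennreal_toReal).aestronglyMeasurable C ?_
  filter_upwards [Measure.rnDeriv_le_one_of_le h,
    Measure.rnDeriv_smul_left_of_ne_top μ ν (ENNReal.ofReal_ne_top (r := c))] with x h1 h2
  refine hC _ ⟨ENNReal.toReal_nonneg, ?_⟩
  rw [h2] at h1
  have h3 := ENNReal.toReal_mono ENNReal.one_ne_top h1
  simp only [Pi.smul_apply, smul_eq_mul, ENNReal.toReal_mul, ENNReal.toReal_ofReal hc.le,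
    ENNReal.toReal_one] at h3
  rw [← one_div, le_div_iff₀ hc]
  linarith

lemma integral_llr_nonneg [IsProbabilityMeasure μ] [IsProbabilityMeasure ν] (hμν : μ ≪ ν)
    (h : Integrable (llr μ ν) μ) : 0 ≤ ∫ x, llr μ ν x ∂μ := by
  simpa using InformationTheory.integral_llr_add_sub_measure_univ_nonneg hμν h

lemma KL_self [SigmaFinite μ] : KL μ μ = 0 := by
  rw [KL]
  have h : Integrable (llr μ μ) μ := (integrable_zero _ _ _).congr (llr_self μ).symm
  rw [if_pos ⟨Measure.AbsolutelyContinuous.rfl, h⟩, integral_congr_ae (llr_self μ)]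
  simp

lemma KL_of_ac_of_integrable (hμν : μ ≪ ν) (h : Integrable (llr μ ν) μ) :
    KL μ ν = ENNReal.ofReal (∫ x, llr μ ν x ∂μ) :=
  if_pos ⟨hμν, h⟩

lemma ac_and_integrable_of_KL_ne_top (h : KL μ ν ≠ ⊤) : μ ≪ ν ∧ Integrable (llr μ ν) μ := by
  by_contra hn
  exact h (if_neg hn)

lemma isProbabilityMeasure_mixture [IsProbabilityMeasure μ] [IsProbabilityMeasure ν] {a b : ℝ}
    (ha : 0 ≤ a) (hb : 0 ≤ b) (hab : a + b = 1) :
    IsProbabilityMeasure (ENNReal.ofReal a • μ + ENNReal.ofReal b • ν) :=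
  ⟨by simp [← ENNReal.ofReal_add ha hb, hab]⟩

end Helpers

/-- optimal solution of the γ-diffusion-projection step.
For probability measures `μ, ν`, `γ ∈ (0,1]` and `π := (1−γ)μ + γν`, the mixture `π`
minimizes `ρ ↦ (1−γ)·KL(μ‖ρ) + γ·KL(ν‖ρ)` over all probability measures `ρ`. -/
theorem mixture_minimizes_kl {α : Type*} [MeasurableSpace α]
    (μ ν : Measure α) [IsProbabilityMeasure μ] [IsProbabilityMeasure ν]
    (γ : ℝ) (hγ : γ ∈ Set.Ioc (0 : ℝ) 1) :
    ∀ (ρ : Measure α) [IsProbabilityMeasure ρ],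
      ENNReal.ofReal (1 - γ) * KL μ (ENNReal.ofReal (1 - γ) • μ + ENNReal.ofReal γ • ν)
          + ENNReal.ofReal γ * KL ν (ENNReal.ofReal (1 - γ) • μ + ENNReal.ofReal γ • ν)
        ≤ ENNReal.ofReal (1 - γ) * KL μ ρ + ENNReal.ofReal γ * KL ν ρ := by
  intro ρ _
  obtain ⟨hb, hb1⟩ := hγ
  rcases hb1.eq_or_lt with rfl | hb1
  · simp [KL_self]
  have ha : 0 < 1 - γ := by linarith
  set a := 1 - γ
  have : IsProbabilityMeasure (ENNReal.ofReal a • μ + ENNReal.ofReal γ • ν) :=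
    isProbabilityMeasure_mixture ha.le hb.le (by simp [a])
  set η := ENNReal.ofReal a • μ + ENNReal.ofReal γ • ν with hη
  have ha0 : ENNReal.ofReal a ≠ 0 := by simpa using ha
  have hb0 : ENNReal.ofReal γ ≠ 0 := by simpa using hb
  by_cases hμ : KL μ ρ = ⊤
  · simp [hμ, ENNReal.mul_top ha0]
  by_cases hν : KL ν ρ = ⊤
  · simp [hν, ENNReal.mul_top hb0]
  obtain ⟨hμρ, hμi⟩ := ac_and_integrable_of_KL_ne_top hμ
  obtain ⟨hνρ, hνi⟩ := ac_and_integrable_of_KL_ne_top hν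
  have hμle : ENNReal.ofReal a • μ ≤ η := Measure.le_add_right le_rfl
  have hνle : ENNReal.ofReal γ • ν ≤ η := Measure.le_add_left le_rfl
  have hμη : μ ≪ η :=
    (Measure.absolutelyContinuous_smul ha0).trans hμle.absolutelyContinuous
  have hνη : ν ≪ η :=
    (Measure.absolutelyContinuous_smul hb0).trans hνle.absolutelyContinuous
  have hηρ : η ≪ ρ := Measure.AbsolutelyContinuous.add_left (hμρ.smul_left _) (hνρ.smul_left _)
  have hμηi := integrable_llr_of_smul_le hμη ha hμle
  have hνηi := integrable_llr_of_smul_le hνη hb hνle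
  have hμeq := llr_ae_eq_add_of_ac hμη hηρ
  have hνeq := llr_ae_eq_add_of_ac hνη hηρ
  have hημi : Integrable (llr η ρ) μ := by
    simpa using (hμi.congr hμeq).sub hμηi
  have hηνi : Integrable (llr η ρ) ν := by
    simpa using (hνi.congr hνeq).sub hνηi
  have hημi' := hημi.smul_measure (ENNReal.ofReal_ne_top (r := a))
  have hηνi' := hηνi.smul_measure (ENNReal.ofReal_ne_top (r := γ))
  have hgibbs := integral_llr_nonneg hηρ (hημi'.add_measure hηνi')
  have hsplit : ∫ x, llr η ρ x ∂η = a * ∫ x, llr η ρ x ∂μ + γ * ∫ x, llr η ρ x ∂ν := by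
    conv_lhs => rw [hη]
    rw [integral_add_measure hημi' hηνi', integral_smul_measure, integral_smul_measure,
      ENNReal.toReal_ofReal ha.le, ENNReal.toReal_ofReal hb.le, smul_eq_mul, smul_eq_mul]
  have hμsum : ∫ x, llr μ ρ x ∂μ = ∫ x, llr μ η x ∂μ + ∫ x, llr η ρ x ∂μ := by
    rw [integral_congr_ae hμeq, integral_add' hμηi hημi]
  have hνsum : ∫ x, llr ν ρ x ∂ν = ∫ x, llr ν η x ∂ν + ∫ x, llr η ρ x ∂ν := by
    rw [integral_congr_ae hνeq, integral_add' hνηi hηνi]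
  rw [KL_of_ac_of_integrable hμη hμηi, KL_of_ac_of_integrable hνη hνηi,
    KL_of_ac_of_integrable hμρ hμi, KL_of_ac_of_integrable hνρ hνi,
    ← ENNReal.ofReal_mul ha.le, ← ENNReal.ofReal_mul hb.le, ← ENNReal.ofReal_mul ha.le,
    ← ENNReal.ofReal_mul hb.le,
    ← ENNReal.ofReal_add (mul_nonneg ha.le (integral_llr_nonneg hμη hμηi))
      (mul_nonneg hb.le (integral_llr_nonneg hνη hνηi)),
    ← ENNReal.ofReal_add (mul_nonneg ha.le (integral_llr_nonneg hμρ hμi))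
      (mul_nonneg hb.le (integral_llr_nonneg hνρ hνi))]
  refine ENNReal.ofReal_le_ofReal ?_
  rw [hμsum, hνsum]
  linarith
end

section
/- Let P₁, P₂ be probability measures on ℝ^d × ℝ^d such that the first coordinate is integrable under both, let γ ∈ (0,1], and set P := (1−γ)P₁ + γP₂. Let ρ, ρ₁, ρ₂ denote the second-coordinate marginals of P, P₁, P₂ respectively, so that ρ₂ ≪ ρ, and define δ(x) := γ·(dρ₂/dρ)(x). Let m, m₁, m₂ : ℝ^d → ℝ^d be versions of the conditional expectation of the first coordinate given the second coordinate under P, P₁, P₂ respectively. Then for ρ-almost every x, m(x) = (1 − δ(x))·m₁(x) + δ(x)·m₂(x). (The posterior-mean mixing formula at the heart of the proof of Proposition 2 of the paper, showing the γ-SFBD drift update is a pointwise convex combination weighted by the Radon–Nikodym derivative of the marginals.) -/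
open MeasureTheory ProbabilityTheory Real
open scoped ENNReal NNReal

/-- `f` is a version of the conditional expectation of the first coordinate given the second
under `Q`: for every bounded measurable `g : ℝ^d → ℝ`,
`∫ x₀·g(x_t) dQ(x₀,x_t) = ∫ f(x_t)·g(x_t) dQ_t(x_t)` where `Q_t` is the second marginal. -/
def IsCondMeanFst {d : ℕ}
    (Q : Measure (EuclideanSpace ℝ (Fin d) × EuclideanSpace ℝ (Fin d)))
    (f : EuclideanSpace ℝ (Fin d) → EuclideanSpace ℝ (Fin d)) : Prop :=
  ∀ g : EuclideanSpace ℝ (Fin d) → ℝ, Measurable g → (∃ C, ∀ x, |g x| ≤ C) →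
    ∫ p, g p.2 • p.1 ∂Q = ∫ x, g x • f x ∂(Q.map Prod.snd)

/-- The set-integral form of the defining identity, with a bounded measurable weight. -/
lemma IsCondMeanFst.setIntegral_smul {d : ℕ}
    {Q : Measure (EuclideanSpace ℝ (Fin d) × EuclideanSpace ℝ (Fin d))}
    {f : EuclideanSpace ℝ (Fin d) → EuclideanSpace ℝ (Fin d)} (h : IsCondMeanFst Q f)
    {w : EuclideanSpace ℝ (Fin d) → ℝ} (hw : Measurable w) {C : ℝ} (hC : ∀ x, |w x| ≤ C)
    {B : Set (EuclideanSpace ℝ (Fin d))} (hB : MeasurableSet B) :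
    ∫ x in B, w x • f x ∂(Q.map Prod.snd) = ∫ p, B.indicator w p.2 • p.1 ∂Q := by
  rw [h _ (hw.indicator hB) ⟨C, fun x => ?_⟩, ← integral_indicator hB]
  · simp only [Set.indicator_smul_apply_left]
  · by_cases hx : x ∈ B
    · simpa [hx] using hC x
    · simpa [hx] using (abs_nonneg _).trans (hC x)

/-- A convex combination of set integrals against `ρ₁` and `ρ₂`, written as one set integral
against the mixture of `ρ₁` and `ρ₂`. -/
lemma setIntegral_mixture_rnDeriv {α E : Type*} [MeasurableSpace α] [NormedAddCommGroup E]
    [NormedSpace ℝ E] {ρ ρ₁ ρ₂ : Measure α} [IsFiniteMeasure ρ] [IsFiniteMeasure ρ₁]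
    [IsFiniteMeasure ρ₂] {γ : ℝ} (hγ : γ ∈ Set.Icc (0 : ℝ) 1)
    (hρ : ρ = ENNReal.ofReal (1 - γ) • ρ₁ + ENNReal.ofReal γ • ρ₂) (hac : ρ₂ ≪ ρ)
    {f₁ f₂ : α → E} (h₁ : Integrable f₁ ρ) (h₁₁ : Integrable f₁ ρ₁) (h₁₂ : Integrable f₁ ρ₂)
    (h₂ : Integrable f₂ ρ₂) {B : Set α} (hB : MeasurableSet B) :
    ∫ x in B, f₁ x + γ • (ρ₂.rnDeriv ρ x).toReal • (f₂ x - f₁ x) ∂ρ =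
      (1 - γ) • ∫ x in B, f₁ x ∂ρ₁ + γ • ∫ x in B, f₂ x ∂ρ₂ := by
  have hd : Integrable (fun x => (ρ₂.rnDeriv ρ x).toReal • (f₂ x - f₁ x)) ρ :=
    (integrable_rnDeriv_smul_iff hac).2 (h₂.sub h₁₂)
  have hmix : ∫ x in B, f₁ x ∂ρ = (1 - γ) • ∫ x in B, f₁ x ∂ρ₁ + γ • ∫ x in B, f₁ x ∂ρ₂ := by
    rw [hρ, Measure.restrict_add, Measure.restrict_smul, Measure.restrict_smul,
      integral_add_measure (h₁₁.restrict.smul_measure ENNReal.ofReal_ne_top)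
        (h₁₂.restrict.smul_measure ENNReal.ofReal_ne_top),
      integral_smul_measure, integral_smul_measure,
      ENNReal.toReal_ofReal (sub_nonneg.2 hγ.2), ENNReal.toReal_ofReal hγ.1]
  rw [integral_add h₁.restrict (hd.fun_smul γ).restrict, integral_smul,
    setIntegral_rnDeriv_smul hac hB, integral_sub h₂.restrict h₁₂.restrict, hmix, smul_sub]
  abel

/-- posterior-mean mixing formula, Proposition 2.
With `P := (1−γ)P₁ + γP₂`, second marginals `ρ, ρ₁, ρ₂`, `δ(x) := γ·(dρ₂/dρ)(x)`, and `m, m₁, m₂`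
versions of the conditional mean of the first coordinate given the second under `P, P₁, P₂`,
one has `ρ₂ ≪ ρ` and, for `ρ`-a.e. `x`, `m(x) = (1 − δ(x))·m₁(x) + δ(x)·m₂(x)`. -/
theorem condMean_mixture {d : ℕ}
    (P₁ P₂ : Measure (EuclideanSpace ℝ (Fin d) × EuclideanSpace ℝ (Fin d)))
    [IsProbabilityMeasure P₁] [IsProbabilityMeasure P₂]
    (hint₁ : Integrable (fun p => p.1) P₁) (hint₂ : Integrable (fun p => p.1) P₂)
    (γ : ℝ) (hγ : γ ∈ Set.Ioc (0 : ℝ) 1)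
    (m m₁ m₂ : EuclideanSpace ℝ (Fin d) → EuclideanSpace ℝ (Fin d))
    (hm : Measurable m) (hm₁ : Measurable m₁) (hm₂ : Measurable m₂)
    (hcm : IsCondMeanFst (ENNReal.ofReal (1 - γ) • P₁ + ENNReal.ofReal γ • P₂) m)
    (hcm₁ : IsCondMeanFst P₁ m₁) (hcm₂ : IsCondMeanFst P₂ m₂) :
    P₂.map Prod.snd ≪ (ENNReal.ofReal (1 - γ) • P₁ + ENNReal.ofReal γ • P₂).map Prod.snd ∧
    ∀ᵐ x ∂((ENNReal.ofReal (1 - γ) • P₁ + ENNReal.ofReal γ • P₂).map Prod.snd),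
      m x = (1 - γ * ((P₂.map Prod.snd).rnDeriv
                ((ENNReal.ofReal (1 - γ) • P₁ + ENNReal.ofReal γ • P₂).map Prod.snd) x).toReal)
              • m₁ x
            + (γ * ((P₂.map Prod.snd).rnDeriv
                ((ENNReal.ofReal (1 - γ) • P₁ + ENNReal.ofReal γ • P₂).map Prod.snd) x).toReal)
              • m₂ x := by
  set P := ENNReal.ofReal (1 - γ) • P₁ + ENNReal.ofReal γ • P₂ with hP
  set ρ := P.map Prod.snd with hρdef
  set ρ₁ := P₁.map Prod.snd
  set ρ₂ := P₂.map Prod.snd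
  have hPfin : IsFiniteMeasure P := by
    have := P₁.smul_finite (ENNReal.ofReal_ne_top (r := 1 - γ))
    have := P₂.smul_finite (ENNReal.ofReal_ne_top (r := γ))
    infer_instance
  have hρ : ρ = ENNReal.ofReal (1 - γ) • ρ₁ + ENNReal.ofReal γ • ρ₂ := by
    rw [hρdef, hP, Measure.map_add _ _ measurable_snd, Measure.map_smul, Measure.map_smul]
  have hac : ρ₂ ≪ ρ := by
    rw [hρ]
    exact (Measure.absolutelyContinuous_smul (ENNReal.ofReal_pos.2 hγ.1).ne').trans
      (Measure.absolutelyContinuous_of_le (Measure.le_add_left le_rfl))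
  refine ⟨hac, ?_⟩
  -- A positive weight making all three versions bounded.
  let w : EuclideanSpace ℝ (Fin d) → ℝ := fun x => (1 + ‖m x‖ + ‖m₁ x‖ + ‖m₂ x‖)⁻¹
  have hwpos (x) : 0 < w x := by positivity
  have hw : Measurable w := by fun_prop
  have hw_le (x) : |w x| ≤ 1 := by
    rw [abs_of_pos (hwpos x)]
    refine inv_le_one_of_one_le₀ ?_
    rw [add_assoc, add_assoc]
    exact le_add_of_nonneg_right (by positivity)
  have hwint {f : EuclideanSpace ℝ (Fin d) → EuclideanSpace ℝ (Fin d)} (hf : Measurable f)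
      (hle : ∀ x, ‖f x‖ ≤ 1 + ‖m x‖ + ‖m₁ x‖ + ‖m₂ x‖)
      (ν : Measure (EuclideanSpace ℝ (Fin d))) [IsFiniteMeasure ν] :
      Integrable (fun x => w x • f x) ν := by
    refine .of_bound (hw.smul hf).aestronglyMeasurable 1 (.of_forall fun x => ?_)
    rw [norm_smul, Real.norm_of_nonneg (hwpos x).le, inv_mul_le_one₀ (by positivity)]
    exact hle x
  have hle (x) : ‖m x‖ ≤ 1 + ‖m x‖ + ‖m₁ x‖ + ‖m₂ x‖ := by
    linarith [norm_nonneg (m₁ x), norm_nonneg (m₂ x)]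
  have hle₁ (x) : ‖m₁ x‖ ≤ 1 + ‖m x‖ + ‖m₁ x‖ + ‖m₂ x‖ := by
    linarith [norm_nonneg (m x), norm_nonneg (m₂ x)]
  have hle₂ (x) : ‖m₂ x‖ ≤ 1 + ‖m x‖ + ‖m₁ x‖ + ‖m₂ x‖ := by
    linarith [norm_nonneg (m x), norm_nonneg (m₁ x)]
  have hd : Integrable (fun x => (ρ₂.rnDeriv ρ x).toReal • (w x • m₂ x - w x • m₁ x)) ρ :=
    (integrable_rnDeriv_smul_iff hac).2 ((hwint hm₂ hle₂ ρ₂).sub (hwint hm₁ hle₁ ρ₂))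
  have key : (fun x => w x • m x) =ᵐ[ρ] fun x =>
      w x • m₁ x + γ • (ρ₂.rnDeriv ρ x).toReal • (w x • m₂ x - w x • m₁ x) := by
    refine Integrable.ae_eq_of_forall_setIntegral_eq _ _ (hwint hm hle ρ)
      ((hwint hm₁ hle₁ ρ).add (hd.smul γ)) fun B hB _ => ?_
    have hgint {Q : Measure (EuclideanSpace ℝ (Fin d) × EuclideanSpace ℝ (Fin d))}
        (hQ : Integrable (fun p => p.1) Q) :
        Integrable (fun p => B.indicator w p.2 • p.1) Q := by
      refine hQ.bdd_smul 1 ((hw.indicator hB).comp measurable_snd).aestronglyMeasurable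
        (.of_forall fun p => ?_)
      exact (norm_indicator_le_norm_self w p.2).trans (hw_le p.2)
    rw [setIntegral_mixture_rnDeriv (Set.Ioc_subset_Icc_self hγ) hρ hac (hwint hm₁ hle₁ ρ)
      (hwint hm₁ hle₁ ρ₁) (hwint hm₁ hle₁ ρ₂) (hwint hm₂ hle₂ ρ₂) hB,
      hcm.setIntegral_smul hw hw_le hB, hcm₁.setIntegral_smul hw hw_le hB,
      hcm₂.setIntegral_smul hw hw_le hB, hP,
      integral_add_measure ((hgint hint₁).smul_measure ENNReal.ofReal_ne_top)
        ((hgint hint₂).smul_measure ENNReal.ofReal_ne_top),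
      integral_smul_measure, integral_smul_measure,
      ENNReal.toReal_ofReal (sub_nonneg.2 hγ.2), ENNReal.toReal_ofReal hγ.1.le]
  filter_upwards [key] with x hx
  refine smul_right_injective _ (hwpos x).ne' (hx.trans ?_)
  module
end
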